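/- Let U ⊆ X = X_1 ∪ ⋯ ∪ X_k contain exactly N elements U_i of each X_i, with N + 1 ≤ n_i for all i. Let H be the square matrix over ℤ[x_v : v ∈ X], indexed by the vertices of X ∖ U, with entry e_1(X_{i+1}) at each diagonal position (u,u) with u ∈ X_i ∖ U_i, entry −x_v at each position (u,v) with u ∈ X_i ∖ U_i and v ∈ X_{i+1} ∖ U_{i+1}, and 0 elsewhere (indices modulo k). Then det(H) = (∏_{i=1}^k e_1(X_i)^{n_{i-1}−(N+1)}) · (∏_{j=1}^k e_1(X_j) − ∏_{j=1}^k e_1(X_j ∖ U_j)), where n_0 = n_k. -/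

import Mathlib

universe u

open Classical in
/-- The matrix `H` over `ℤ[x_v : v ∈ X]`, indexed by the vertices of `X ∖ U`:
its diagonal entry at `(u, u)` with `u ∈ X i ∖ U i` is `e₁(X (i+1))`, its entry at
`(u, v)` with `u ∈ X i ∖ U i` and `v ∈ X (i+1) ∖ U (i+1)` is decreased by `x_v`,
and it vanishes elsewhere (indices modulo `k+1`). -/
noncomputable def HMat (k : ℕ) (X : Fin (k + 1) → Type u) [∀ i, Fintype (X i)]
    [∀ i, DecidableEq (X i)] (U : ∀ i, Finset (X i)) :
    Matrix (Σ i : Fin (k + 1), {v : X i // v ∉ U i})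
      (Σ i : Fin (k + 1), {v : X i // v ∉ U i}) (MvPolynomial (Σ i, X i) ℤ) :=
  fun p q =>
    (if p = q then ∑ w : X (p.1 + 1), MvPolynomial.X (⟨p.1 + 1, w⟩ : Σ i, X i) else 0) -
    (if q.1 = p.1 + 1 then MvPolynomial.X (⟨q.1, q.2.1⟩ : Σ i, X i) else 0)

theorem cyc_det {K : Type*} [Field K] (k : ℕ) (c : Fin (k + 1) → K) :
    (1 - Matrix.of (fun i j : Fin (k + 1) => if j = i + 1 then c i else 0)).det
      = 1 - ∏ i, c i := by
  rcases k with _ | k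
  · simp [Subsingleton.elim (0 : Fin 1) 1]
  · rw [Matrix.det_succ_column_zero, Fin.sum_univ_succ, Fin.sum_univ_castSucc]
    have hz : ∀ i : Fin k, (1 - Matrix.of (fun i j : Fin (k + 1 + 1) =>
        if j = i + 1 then c i else 0)) i.castSucc.succ 0 = 0 := by
      intro i
      have h1 : (0 : Fin (k + 1 + 1)) ≠ i.castSucc.succ + 1 := by
        rw [Fin.succ_castSucc, Fin.coeSucc_eq_succ]
        exact (Fin.succ_ne_zero _).symm
      rw [Matrix.sub_apply, Matrix.of_apply, if_neg h1, Matrix.one_apply_ne (Fin.succ_ne_zero _),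
        sub_zero]
    have h00 : (1 - Matrix.of (fun i j : Fin (k + 1 + 1) =>
        if j = i + 1 then c i else 0)) 0 0 = 1 := by
      simp [Fin.ext_iff]
    have hl0 : (1 - Matrix.of (fun i j : Fin (k + 1 + 1) =>
        if j = i + 1 then c i else 0)) (Fin.last k).succ 0 = - c (Fin.last (k + 1)) := by
      simp [Matrix.one_apply]
    have hd0 : ((1 - Matrix.of (fun i j : Fin (k + 1 + 1) =>
        if j = i + 1 then c i else 0)).submatrix (Fin.succAbove 0) Fin.succ).det = 1 := by
      rw [Matrix.det_of_isUpperTriangular]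
      · apply Finset.prod_eq_one
        intro i _
        simp
      · intro i j hij
        have hij' : j < i := hij
        have h2 : ¬ (j.succ = i.succ + 1) := by
          intro h
          rcases Fin.eq_castSucc_or_eq_last i with ⟨i', rfl⟩ | rfl
          · rw [Fin.succ_castSucc, Fin.coeSucc_eq_succ] at h
            simp only [Fin.ext_iff, Fin.lt_def, Fin.val_succ, Fin.val_castSucc] at h hij'
            omega
          · simp at h
        simp [Matrix.one_apply, h2, hij'.ne']
    have hdl : ((1 - Matrix.of (fun i j : Fin (k + 1 + 1) =>
        if j = i + 1 then c i else 0)).submatrix (Fin.succAbove (Fin.last k).succ) Fin.succ).det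
        = ∏ i : Fin (k + 1), - c i.castSucc := by
      rw [Fin.succ_last, Matrix.det_of_isLowerTriangular]
      · apply Finset.prod_congr rfl
        intro i _
        simp [Matrix.one_apply, Fin.ext_iff]
      · intro i j hij
        have hij' : i < j := by simpa using hij
        have h1 : ¬ (i.castSucc = j.succ) := by
          simp only [Fin.ext_iff, Fin.lt_def, Fin.val_succ, Fin.val_castSucc] at hij' ⊢
          omega
        simp [Matrix.one_apply, h1, hij'.ne']
    rw [Finset.sum_eq_zero (fun i _ => by rw [hz]; simp), h00, hl0, hd0, hdl,
      Fin.prod_univ_castSucc c, Finset.prod_neg]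
    have : ((-1 : K) ^ (k + 1)) * (-1) ^ (k + 1) = 1 := by
      rw [← mul_pow]; simp
    simp only [Fin.val_succ, Fin.val_last, Fin.val_zero, Finset.card_univ, Fintype.card_fin]
    linear_combination (-(∏ i : Fin (k + 1), c i.castSucc) * c (Fin.last (k + 1))) * this

theorem field_case {K : Type*} [Field K] (k : ℕ) (V : Fin (k + 1) → Type u)
    [∀ i, Fintype (V i)] [DecidableEq (Σ i, V i)]
    (e : Fin (k + 1) → K) (he : ∀ i, e i ≠ 0) (x : (Σ i, V i) → K) :
    (Matrix.of (fun p q : Σ i, V i => (if p = q then e (p.1 + 1) else 0) -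
      (if q.1 = p.1 + 1 then x q else 0))).det =
    (∏ i, e (i + 1) ^ Fintype.card (V i)) * (1 - ∏ i, (∑ v, x ⟨i, v⟩) / e (i + 1)) := by
  have key : Matrix.of (fun p q : Σ i, V i => (if p = q then e (p.1 + 1) else 0) -
      (if q.1 = p.1 + 1 then x q else 0)) =
      Matrix.diagonal (fun p : Σ i, V i => e (p.1 + 1)) *
      (1 - (Matrix.of (fun (p : Σ i, V i) (i : Fin (k + 1)) =>
          if i = p.1 + 1 then (e (p.1 + 1))⁻¹ else 0)) *
        (Matrix.of (fun (i : Fin (k + 1)) (q : Σ i, V i) => if q.1 = i then x q else 0))) := by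
    ext p q
    rw [Matrix.diagonal_mul]
    simp only [Matrix.of_apply, Matrix.sub_apply, Matrix.mul_apply, Matrix.one_apply, ite_mul,
      zero_mul, Finset.sum_ite_eq', Finset.mem_univ, if_true]
    have := he (p.1 + 1)
    simp only [mul_sub, mul_ite, mul_one, mul_zero]
    congr 1
    by_cases h : q.1 = p.1 + 1
    · simp [h, this]
    · simp [h, Ne.symm h]
  rw [key, Matrix.det_mul, Matrix.det_diagonal, Matrix.det_one_sub_mul_comm,
    Fintype.prod_sigma]
  congr 1
  · simp
  · rw [← cyc_det]
    congr 2
    ext i j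
    simp only [Matrix.of_apply, Matrix.mul_apply, Fintype.sum_sigma]
    rw [Finset.sum_eq_single i]
    · by_cases h : j = i + 1 <;> simp [h, div_eq_mul_inv, Finset.sum_mul]
    · intro b _ hb
      simp [hb]
    · simp

open Classical in
/-- `det H = (∏ᵢ e₁(Xᵢ)^(n_{i-1}−(N+1))) · (∏ⱼ e₁(Xⱼ) − ∏ⱼ e₁(Xⱼ ∖ Uⱼ))`, where
`U i ⊆ X i` has exactly `N` elements and `N + 1 ≤ n i`, indices modulo `k+1`. -/
theorem stmt8 (k N : ℕ) (X : Fin (k + 1) → Type u) [∀ i, Fintype (X i)]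
    [∀ i, DecidableEq (X i)] (n : Fin (k + 1) → ℕ)
    (hcard : ∀ i, Fintype.card (X i) = n i)
    (U : ∀ i, Finset (X i)) (hU : ∀ i, (U i).card = N) (hn : ∀ i, N + 1 ≤ n i) :
    (HMat k X U).det =
      (∏ i, (∑ v : X i, MvPolynomial.X (⟨i, v⟩ : Σ i, X i)) ^ (n (i - 1) - (N + 1))) *
        ((∏ j, ∑ v : X j, MvPolynomial.X (⟨j, v⟩ : Σ i, X i)) -
          ∏ j, ∑ v ∈ Finset.univ \ U j, MvPolynomial.X (⟨j, v⟩ : Σ i, X i)) := by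
  have hE : ∀ i, (∑ v : X i, (MvPolynomial.X (⟨i, v⟩ : Σ i, X i) :
      MvPolynomial (Σ i, X i) ℤ)) ≠ 0 := by
    intro i h0
    have hpos : 0 < Fintype.card (X i) := by
      rw [hcard]; have := hn i; omega
    have h1 := congrArg (MvPolynomial.eval (fun _ => (1 : ℤ))) h0
    simp at h1
    have := hpos.ne'
    simp_all
  let φ := algebraMap (MvPolynomial (Σ i, X i) ℤ) (FractionRing (MvPolynomial (Σ i, X i) ℤ))
  have hφ : Function.Injective φ := IsFractionRing.injective _ _
  let E : Fin (k + 1) → MvPolynomial (Σ i, X i) ℤ :=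
    fun i => ∑ v : X i, MvPolynomial.X (⟨i, v⟩ : Σ i, X i)
  let F : Fin (k + 1) → MvPolynomial (Σ i, X i) ℤ :=
    fun i => ∑ v ∈ Finset.univ \ U i, MvPolynomial.X (⟨i, v⟩ : Σ i, X i)
  have he : ∀ i, φ (E i) ≠ 0 := fun i => (map_ne_zero_iff φ hφ).2 (hE i)
  apply hφ
  change φ _ = φ ((∏ i, E i ^ (n (i - 1) - (N + 1))) * ((∏ j, E j) - ∏ j, F j))
  rw [RingHom.map_det]
  have hm : φ.mapMatrix (HMat k X U) = Matrix.of
      (fun p q : Σ i : Fin (k + 1), {v : X i // v ∉ U i} =>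
      (if p = q then φ (E (p.1 + 1)) else 0) -
      (if q.1 = p.1 + 1 then φ (MvPolynomial.X (⟨q.1, q.2.1⟩ : Σ i, X i)) else 0)) := by
    ext p q
    simp only [RingHom.mapMatrix_apply, Matrix.map_apply, HMat, Matrix.of_apply, map_sub]
    congr 1
    · split_ifs <;> simp [E]
    · split_ifs <;> simp
  rw [hm, field_case k (fun i => {v : X i // v ∉ U i}) (fun i => φ (E i)) he
    (fun q => φ (MvPolynomial.X (⟨q.1, q.2.1⟩ : Σ i, X i)))]
  have hF : ∀ i, ∑ v : {v : X i // v ∉ U i}, φ (MvPolynomial.X (⟨i, v.1⟩ : Σ i, X i))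
      = φ (F i) := by
    intro i
    simp only [F, map_sum]
    symm
    apply Finset.sum_subtype
    simp
  have hc : ∀ i, Fintype.card {v : X i // v ∉ U i} = (n i - (N + 1)) + 1 := by
    intro i
    have h1 := Fintype.card_subtype_compl (fun v : X i => v ∈ U i)
    have h2 : Fintype.card {v : X i // v ∈ U i} = N := by simp [hU]
    have := hn i
    rw [h2, hcard] at h1
    have h3 : Fintype.card {v : X i // v ∉ U i} = n i - N := by convert h1
    rw [h3]
    omega
  have hs1 : ∏ i : Fin (k + 1), φ (E (i + 1)) = ∏ i, φ (E i) :=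
    Equiv.prod_comp (Equiv.addRight (1 : Fin (k + 1))) (fun i => φ (E i))
  have hs2 : ∏ i : Fin (k + 1), φ (E (i + 1)) ^ (n i - (N + 1)) =
      ∏ i, φ (E i) ^ (n (i - 1) - (N + 1)) := by
    rw [← Equiv.prod_comp (Equiv.addRight (1 : Fin (k + 1)))
      (fun i => φ (E i) ^ (n (i - 1) - (N + 1)))]
    simp
  have hP : ∏ i, φ (E i) ≠ 0 := Finset.prod_ne_zero_iff.2 (fun i _ => he i)
  simp only [hF, hc, pow_succ, Finset.prod_mul_distrib, Finset.prod_div_distrib, hs1, hs2,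
    map_mul, map_sub, map_prod, map_pow]
  field_simp
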